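/- arXiv:0704.1489 — 6 statements merged into one kernel-verified Lean document; each statement's English description precedes it below -/
import Mathlib

section
/- Let k ≤ n be positive integers and let q be a permutation of length k. Then the total number of very tight occurrences of q, summed over all permutations p of length n, equals (n-k+1)^2 · (n-k)!. Equivalently, the expected number of very tight occurrences of q in a uniformly random permutation of length n is (n-k+1)^2 / (C(n,k) · k!). -/
/-- `p` has a *very tight* occurrence of the pattern `q` in the window of
positions `i, i+1, …, i+k-1` (0-indexed; this corresponds to the window
`p_{i+1} ⋯ p_{i+k}` in 1-indexed notation): the window is order-isomorphic
to `q` and its set of values is an interval of `k` consecutive values. -/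
def IsVTO {n k : ℕ} (p : Equiv.Perm (Fin n)) (q : Equiv.Perm (Fin k)) (i : ℕ) : Prop :=
  ∃ _hik : i + k ≤ n, ∃ a : ℕ, a + k ≤ n ∧
    (∀ j r : Fin k, q j < q r ↔
      p ⟨i + (j : ℕ), by have := j.isLt; omega⟩ <
        p ⟨i + (r : ℕ), by have := r.isLt; omega⟩) ∧
    Finset.image (fun j : Fin k => (p ⟨i + (j : ℕ), by have := j.isLt; omega⟩ : ℕ))
      Finset.univ = Finset.Ico a (a + k)

/-- The number of very tight occurrences of `q` in `p`. -/
noncomputable def numVTO {n k : ℕ} (p : Equiv.Perm (Fin n)) (q : Equiv.Perm (Fin k)) : ℕ :=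
  Set.ncard {i : ℕ | IsVTO p q i}

/-- The permutations of a finite type extending a given partial injection `f j ↦ g j`
are counted by the factorial of the number of remaining points. -/
theorem card_perm_extending {n k : ℕ} (f g : Fin k ↪ Fin n) :
    (Finset.univ.filter fun p : Equiv.Perm (Fin n) => ∀ j, p (f j) = g j).card
      = Nat.factorial (n - k) := by
  classical
  let e₀ : {x // x ∈ Set.range f} ≃ {x // x ∈ Set.range g} :=
    (Equiv.ofInjective f f.injective).symm.trans (Equiv.ofInjective g g.injective)
  let e : Equiv.Perm (Fin n) := e₀.extendSubtype
  have he (j : Fin k) : e (f j) = g j := by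
    have h := e₀.extendSubtype_apply_of_mem (f j) ⟨j, rfl⟩
    refine h.trans ?_
    change (Equiv.ofInjective g g.injective ((Equiv.ofInjective f f.injective).symm _) : Fin n) = _
    rw [Equiv.ofInjective_symm_apply]
    rfl
  let P : Fin n → Prop := fun x => x ∉ Set.range f
  have hcard : Fintype.card {x // P x} = n - k := by
    rw [Fintype.card_subtype_compl]
    have h := Set.card_range_of_injective f.injective
    rw [Fintype.card_fin] at h ⊢
    exact congrArg (n - ·) (by convert h)
  rw [← hcard, ← Fintype.card_perm,
    Fintype.card_congr (Equiv.Perm.subtypeEquivSubtypePerm P), Fintype.card_subtype]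
  refine Finset.card_equiv (Equiv.mulLeft e⁻¹) fun p => ?_
  simp only [Finset.mem_filter, Finset.mem_univ, true_and, P, not_not, Set.forall_mem_range,
    Equiv.coe_mulLeft, Equiv.Perm.mul_apply, Equiv.Perm.inv_eq_iff_eq, he]

/-- An order-isomorphic window onto an interval of values is a translate of the pattern. -/
theorem isVTO_iff {n k : ℕ} (p : Equiv.Perm (Fin n)) (q : Equiv.Perm (Fin k)) (i : ℕ) :
    IsVTO p q i ↔ ∃ _hik : i + k ≤ n, ∃ a : ℕ, a + k ≤ n ∧
      ∀ j : Fin k, (p ⟨i + (j : ℕ), by have := j.isLt; omega⟩ : ℕ) = a + q j := by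
  refine exists_congr fun hik => exists_congr fun a => and_congr_right fun _ => ⟨?_, fun h => ?_⟩
  · rintro ⟨hord, him⟩ j
    let u : Fin k → ℕ := fun m => p ⟨i + (q.symm m : ℕ), by have := (q.symm m).isLt; omega⟩
    let v : Fin k → ℕ := fun m => a + m
    have hu : StrictMono u := fun x y hxy => (hord _ _).1 (by simpa using hxy)
    have hv : StrictMono v := fun x y hxy => Nat.add_lt_add_left hxy a
    have huv : u = v := by
      refine (StrictMono.range_inj hu hv).1 (Set.ext fun y => ?_)
      have hy : y ∈ Set.range u ↔ y ∈ Finset.Ico a (a + k) := by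
        rw [← him]
        simp only [Set.mem_range, Finset.mem_image, Finset.mem_univ, true_and]
        constructor
        · rintro ⟨m, rfl⟩
          exact ⟨q.symm m, rfl⟩
        · rintro ⟨j, rfl⟩
          exact ⟨q j, by simp [u]⟩
      rw [hy, Finset.mem_Ico]
      constructor
      · rintro ⟨h₁, h₂⟩
        exact ⟨⟨y - a, by omega⟩, by simp only [v]; omega⟩
      · rintro ⟨m, rfl⟩
        have := m.isLt
        simp only [v]
        omega
    simpa [u, v] using congrFun huv (q j)
  · refine ⟨fun j r => ?_, Finset.ext fun y => ?_⟩
    · rw [Fin.lt_def, Fin.lt_def, h, h]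
      omega
    · simp only [h, Finset.mem_image, Finset.mem_univ, true_and, Finset.mem_Ico]
      constructor
      · rintro ⟨j, rfl⟩
        have := (q j).isLt
        omega
      · rintro ⟨h₁, h₂⟩
        exact ⟨q.symm ⟨y - a, by omega⟩, by simp only [Equiv.apply_symm_apply]; omega⟩

/-- The embedding of `Fin k` as the window of `Fin n` starting at `i`. -/
def windowEmb {n k : ℕ} (hkn : k ≤ n) (i : Fin (n - k + 1)) : Fin k ↪ Fin n where
  toFun j := ⟨i + j, by have := i.isLt; have := j.isLt; omega⟩
  inj' x y h := by
    simp only [Fin.mk.injEq] at h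
    exact Fin.ext (by omega)

theorem numVTO_eq_card {n k : ℕ} (hk : 0 < k) (hkn : k ≤ n) (p : Equiv.Perm (Fin n))
    (q : Equiv.Perm (Fin k)) :
    numVTO p q = (Finset.univ.filter fun x : Fin (n - k + 1) × Fin (n - k + 1) =>
      ∀ j, p (windowEmb hkn x.1 j) = windowEmb hkn x.2 (q j)).card := by
  have hset : {i : ℕ | IsVTO p q i} =
      ((Finset.univ.filter fun x : Fin (n - k + 1) × Fin (n - k + 1) =>
        ∀ j, p (windowEmb hkn x.1 j) = windowEmb hkn x.2 (q j)).image
          fun x => (x.1 : ℕ) : Finset ℕ) := by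
    ext i
    simp only [Set.mem_ofPred_eq, isVTO_iff, Finset.coe_image, Finset.coe_filter,
      Finset.mem_univ, true_and, Set.mem_image, Prod.exists]
    constructor
    · rintro ⟨hik, a, ha, h⟩
      exact ⟨⟨i, by omega⟩, ⟨a, by omega⟩, fun j => Fin.ext (h j), rfl⟩
    · rintro ⟨i, a, h, rfl⟩
      have := i.isLt
      have := a.isLt
      exact ⟨by omega, a, by omega, fun j => congrArg Fin.val (h j)⟩
  rw [numVTO, hset, Set.ncard_coe_finset, Finset.card_image_of_injOn]
  rintro ⟨i, a⟩ hx ⟨i', b⟩ hy hi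
  obtain rfl : i = i' := Fin.ext hi
  simp only [Finset.coe_filter, Finset.mem_univ, true_and, Set.mem_ofPred_eq] at hx hy
  have h := congrArg Fin.val ((hx ⟨0, hk⟩).symm.trans (hy ⟨0, hk⟩))
  exact Prod.ext rfl (Fin.ext (Nat.add_right_cancel h))

/-- The total number of very tight occurrences of a pattern `q` of length `k`,
summed over all permutations `p` of length `n`, equals `(n-k+1)^2 · (n-k)!`. -/
theorem stmt_0 {n k : ℕ} (hk : 0 < k) (hkn : k ≤ n) (q : Equiv.Perm (Fin k)) :
    ∑ p : Equiv.Perm (Fin n), numVTO p q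
      = (n - k + 1) ^ 2 * Nat.factorial (n - k) := by
  simp only [numVTO_eq_card hk hkn, Finset.card_filter]
  rw [Finset.sum_comm]
  simp only [← Finset.card_filter]
  have h (x : Fin (n - k + 1) × Fin (n - k + 1)) :=
    card_perm_extending (windowEmb hkn x.1) (q.toEmbedding.trans (windowEmb hkn x.2))
  simp only [Function.Embedding.trans_apply, Equiv.coe_toEmbedding] at h
  simp [h, sq]
end

section
/- Let k ≤ n be positive integers, set m = n-k+1, and let q and q' be any two permutations of length k. Then Σ_{i=1}^{m} A(n,i,q) = Σ_{i=1}^{m} A(n,i,q'), where A(n,i,q) denotes the number of permutations of length n that have at least i very tight occurrences of q. -/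
/-- Rearranging the window of positions `i, …, i+k-1` turns very tight occurrences of `q` at `i`
into very tight occurrences of `q'` at `i`. -/
theorem exists_isVTO_mul {n k : ℕ} (q q' : Equiv.Perm (Fin k)) (i : ℕ) :
    ∃ σ : Equiv.Perm (Fin n), ∀ p : Equiv.Perm (Fin n), IsVTO p q i → IsVTO (p * σ) q' i := by
  by_cases hik : i + k ≤ n
  · let window : Fin k ↪ Fin n :=
      ⟨fun j => ⟨i + (j : ℕ), by have := j.isLt; omega⟩, fun a b h => by
        simp only [Fin.mk.injEq] at h
        exact Fin.ext (by omega)⟩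
    let τ : Equiv.Perm (Fin k) := q'.trans q.symm
    have hσ : ∀ j, τ.viaFintypeEmbedding window (window j) = window (τ j) :=
      τ.viaFintypeEmbedding_apply_image window
    refine ⟨τ.viaFintypeEmbedding window, ?_⟩
    rintro p ⟨_, a, ha, hord, himg⟩
    change ∀ j r : Fin k, q j < q r ↔ p (window j) < p (window r) at hord
    change Finset.image (fun j : Fin k => (p (window j) : ℕ)) Finset.univ = _ at himg
    refine ⟨hik, a, ha, ?_, ?_⟩
    · intro j r
      change q' j < q' r ↔ p (τ.viaFintypeEmbedding window (window j)) <
        p (τ.viaFintypeEmbedding window (window r))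
      rw [hσ, hσ, ← hord]
      simp [τ]
    · change Finset.image
        (fun j : Fin k => (p (τ.viaFintypeEmbedding window (window j)) : ℕ)) Finset.univ = _
      simp only [hσ]
      rw [← himg]
      ext x
      simp only [Finset.mem_image, Finset.mem_univ, true_and]
      exact τ.exists_congr_left.trans (by simp)
  · exact ⟨1, fun p h => absurd h.1 hik⟩

theorem card_isVTO_le {n k : ℕ} (q q' : Equiv.Perm (Fin k)) (i : ℕ) :
    Nat.card {p : Equiv.Perm (Fin n) // IsVTO p q i} ≤
      Nat.card {p : Equiv.Perm (Fin n) // IsVTO p q' i} := by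
  obtain ⟨σ, hσ⟩ := exists_isVTO_mul (n := n) q q' i
  exact Nat.card_le_card_of_injective (fun p => ⟨p.1 * σ, hσ p.1 p.2⟩) fun p p' h =>
    Subtype.ext (mul_right_cancel (congrArg Subtype.val h))

open Classical in
theorem numVTO_eq_card_filter {n k : ℕ} (p : Equiv.Perm (Fin n)) (q : Equiv.Perm (Fin k)) :
    numVTO p q = ((Finset.range (n - k + 1)).filter (IsVTO p q)).card := by
  rw [numVTO, ← Set.ncard_coe_finset]
  congr 1
  ext i
  simp only [Set.mem_ofPred_eq, Finset.coe_filter, Finset.mem_range, iff_and_self]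
  rintro ⟨h, -⟩
  omega

theorem sum_card_le_eq_sum {α : Type*} [Fintype α] (f : α → ℕ) (m : ℕ) (hf : ∀ x, f x ≤ m) :
    ∑ i ∈ Finset.Icc 1 m, Nat.card {x // i ≤ f x} = ∑ x, f x := by
  simp only [Nat.card_eq_fintype_card, Fintype.card_subtype, Finset.card_filter]
  rw [Finset.sum_comm]
  refine Finset.sum_congr rfl fun x _ => ?_
  rw [← Finset.card_filter]
  have : (Finset.Icc 1 m).filter (· ≤ f x) = Finset.Icc 1 (f x) := by
    ext i
    have := hf x
    simp only [Finset.mem_filter, Finset.mem_Icc]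
    omega
  rw [this, Nat.card_Icc, Nat.add_sub_cancel]

/-- Double counting of the very tight occurrences of `q` in all permutations. -/
theorem sum_card_le_numVTO {n k : ℕ} (q : Equiv.Perm (Fin k)) :
    ∑ i ∈ Finset.Icc 1 (n - k + 1), Nat.card {p : Equiv.Perm (Fin n) // i ≤ numVTO p q} =
      ∑ i ∈ Finset.range (n - k + 1), Nat.card {p : Equiv.Perm (Fin n) // IsVTO p q i} := by
  classical
  rw [sum_card_le_eq_sum (fun p : Equiv.Perm (Fin n) => numVTO p q)]
  · simp only [numVTO_eq_card_filter, Nat.card_eq_fintype_card, Fintype.card_subtype,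
      Finset.card_filter]
    exact Finset.sum_comm
  · intro p
    rw [numVTO_eq_card_filter]
    exact (Finset.card_filter_le _ _).trans_eq (Finset.card_range _)

/-- With `m = n - k + 1`, the sums `Σ_{i=1}^m A(n,i,q)` of the numbers of
`n`-permutations with at least `i` very tight occurrences of a pattern of
length `k` agree for any two patterns `q, q'` of length `k`. -/
theorem stmt_2 {n k : ℕ} (hk : 0 < k) (hkn : k ≤ n) (q q' : Equiv.Perm (Fin k)) :
    ∑ i ∈ Finset.Icc 1 (n - k + 1),
        Nat.card {p : Equiv.Perm (Fin n) // i ≤ numVTO p q}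
      = ∑ i ∈ Finset.Icc 1 (n - k + 1),
          Nat.card {p : Equiv.Perm (Fin n) // i ≤ numVTO p q'} := by
  rw [sum_card_le_numVTO, sum_card_le_numVTO]
  exact Finset.sum_congr rfl fun i _ => (card_isVTO_le q q' i).antisymm (card_isVTO_le q' q i)
end

section
/- Let q = q_1 q_2 ⋯ q_k be a permutation of length k with q_1 < q_k, and suppose some permutation p of length n has very tight occurrences of q at two distinct starting positions i and i' with i < i' < i + k (i.e., the two occurrences are not disjoint). Then q is condensible; more precisely, for s = k - (i' - i) we have 1 ≤ s ≤ k-1, the rightmost s entries of q are the s largest entries of q, the leftmost s entries of q are the s smallest entries of q, and the leftmost s entries of q form a pattern order-isomorphic to the rightmost s entries of q. -/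
/-- The pattern `q` is condensible with parameter `s`: `1 ≤ s ≤ k-1`, the
rightmost `s` entries of `q` are its `s` largest entries, the leftmost `s`
entries are its `s` smallest entries, and the leftmost `s` entries are
order-isomorphic to the rightmost `s` entries. (0-indexed.) -/
def CondensibleAt {k : ℕ} (q : Equiv.Perm (Fin k)) (s : ℕ) : Prop :=
  ∃ _hs1 : 1 ≤ s, ∃ _hs2 : s ≤ k - 1,
    (∀ j : Fin k, k - s ≤ (j : ℕ) → k - s ≤ (q j : ℕ)) ∧
    (∀ j : Fin k, (j : ℕ) < s → (q j : ℕ) < s) ∧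
    ∀ j r : Fin k, ∀ _hj : (j : ℕ) < s, ∀ _hr : (r : ℕ) < s,
      (q j < q r ↔
        q ⟨(j : ℕ) + (k - s), by omega⟩ < q ⟨(r : ℕ) + (k - s), by omega⟩)

/-- The pattern `q` is condensible. -/
def Condensible {k : ℕ} (q : Equiv.Perm (Fin k)) : Prop :=
  ∃ s : ℕ, CondensibleAt q s

/-- The extension of a permutation of `Fin n` to `ℕ` by the identity. -/
def extendNat {n : ℕ} (p : Equiv.Perm (Fin n)) (x : ℕ) : ℕ :=
  if h : x < n then p ⟨x, h⟩ else x

theorem extendNat_injective {n : ℕ} (p : Equiv.Perm (Fin n)) :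
    Function.Injective (extendNat p) := by
  intro x y hxy
  unfold extendNat at hxy
  split_ifs at hxy with hx hy hy
  · simpa using p.injective (Fin.ext hxy)
  · have := (p ⟨x, hx⟩).isLt
    omega
  · have := (p ⟨y, hy⟩).isLt
    omega
  · exact hxy

/-- In a very tight occurrence, the window is a translate of the pattern. -/
theorem exists_extendNat_add_eq_of_isVTO {n k : ℕ} {p : Equiv.Perm (Fin n)}
    {q : Equiv.Perm (Fin k)} {i : ℕ} (h : IsVTO p q i) :
    ∃ a : ℕ, ∀ j : Fin k, extendNat p (i + j) = a + q j := by
  obtain ⟨hik, a, -, hord, himg⟩ := h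
  refine ⟨a, fun j => ?_⟩
  have hcard : (Finset.Ico a (a + k)).card = k := by simp
  have hwin : (fun x : Fin k => (p ⟨i + (q.symm x : ℕ), by omega⟩ : ℕ)) =
      (Finset.Ico a (a + k)).orderEmbOfFin hcard := by
    refine Finset.orderEmbOfFin_unique hcard (fun x => ?_) (fun x y hxy => ?_)
    · rw [← himg]
      exact Finset.mem_image_of_mem _ (Finset.mem_univ (q.symm x))
    · exact (hord (q.symm x) (q.symm y)).1 (by simpa using hxy)
  have hadd : (fun x : Fin k => a + (x : ℕ)) =
      (Finset.Ico a (a + k)).orderEmbOfFin hcard := by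
    refine Finset.orderEmbOfFin_unique hcard (fun x => ?_) (fun x y hxy => ?_)
    · simp
    · simpa using hxy
  have hj := congrFun (hwin.trans hadd.symm) (q j)
  simp only [Equiv.symm_apply_apply] at hj
  rw [extendNat, dif_pos (by omega), hj]

theorem image_extendNat_Ico {n k : ℕ} {p : Equiv.Perm (Fin n)} (q : Equiv.Perm (Fin k))
    {i a : ℕ} (h : ∀ j : Fin k, extendNat p (i + j) = a + q j) :
    (Finset.Ico i (i + k)).image (extendNat p) = Finset.Ico a (a + k) := by
  refine Finset.eq_of_subset_of_card_le (fun y hy => ?_) ?_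
  · obtain ⟨x, hx, rfl⟩ := Finset.mem_image.1 hy
    rw [Finset.mem_Ico] at hx
    have hx' := h ⟨x - i, by omega⟩
    simp only [Nat.add_sub_cancel' hx.1] at hx'
    rw [hx', Finset.mem_Ico]
    omega
  · rw [Finset.card_image_of_injective _ (extendNat_injective p)]
    simp

/-- If a permutation `p` has very tight occurrences of a pattern `q` (with
first entry smaller than last entry) at two distinct overlapping starting
positions `i < i' < i + k`, then `q` is condensible; more precisely, `q` is
condensible with parameter `s = k - (i' - i)`. -/
theorem stmt_3 {n k : ℕ} (hk : 0 < k) (q : Equiv.Perm (Fin k))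
    (hq : q ⟨0, hk⟩ < q ⟨k - 1, by omega⟩)
    (p : Equiv.Perm (Fin n)) (i i' : ℕ) (h1 : i < i') (h2 : i' < i + k)
    (o1 : IsVTO p q i) (o2 : IsVTO p q i') :
    Condensible q ∧ CondensibleAt q (k - (i' - i)) := by
  obtain ⟨a, ha⟩ := exists_extendNat_add_eq_of_isVTO o1
  obtain ⟨b, hb⟩ := exists_extendNat_add_eq_of_isVTO o2
  have hinj := extendNat_injective p
  have hcard : (Finset.Ico a (a + k) ∩ Finset.Ico b (b + k)).card = i + k - i' := by
    rw [← image_extendNat_Ico q ha, ← image_extendNat_Ico q hb, ← Finset.image_inter _ _ hinj,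
      Finset.card_image_of_injective _ hinj, Finset.Ico_inter_Ico, Nat.card_Ico]
    omega
  rw [Finset.Ico_inter_Ico, Nat.card_Ico] at hcard
  have hshift (j : ℕ) (hj : j + (i' - i) < k) :
      a + (q ⟨j + (i' - i), hj⟩ : ℕ) = b + (q ⟨j, by omega⟩ : ℕ) := by
    rw [← ha, ← hb]
    congr 1
    simp only
    omega
  have hba : b = a + (i' - i) := by
    by_contra hne
    have hab : a = b + (i' - i) := by omega
    have hlast := hshift (k - (i' - i) - 1) (by omega)
    have hk1 : k - (i' - i) - 1 + (i' - i) = k - 1 := by omega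
    simp only [hk1] at hlast
    have hfirst : extendNat p i ∉ Finset.Ico b (b + k) := by
      rw [← image_extendNat_Ico q hb, Finset.mem_image]
      rintro ⟨x, hx, hxi⟩
      rw [hinj hxi, Finset.mem_Ico] at hx
      omega
    have h0 := ha ⟨0, hk⟩
    simp only [add_zero] at h0
    rw [h0, Finset.mem_Ico] at hfirst
    rw [Fin.lt_def] at hq
    have := (q ⟨k - (i' - i) - 1, by omega⟩).isLt
    omega
  have hc : CondensibleAt q (k - (i' - i)) := by
    have hd : k - (k - (i' - i)) = i' - i := by omega
    refine ⟨by omega, by omega, fun j hj => ?_, fun j hj => ?_, fun j r hj hr => ?_⟩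
    · have h := hshift (j - (i' - i)) (by omega)
      have hj' : (j : ℕ) - (i' - i) + (i' - i) = j := by omega
      simp only [hj', Fin.eta] at h
      omega
    · have h := hshift j (by omega)
      have := (q ⟨j + (i' - i), by omega⟩).isLt
      simp only [Fin.eta] at h
      omega
    · have h := hshift j (by omega)
      have h' := hshift r (by omega)
      simp only [Fin.eta] at h h'
      simp only [hd, Fin.lt_def]
      omega
  exact ⟨⟨_, hc⟩, hc⟩
end

section
/- Let q = q_1 q_2 ⋯ q_k be a non-condensible permutation of length k with q_1 < q_k. Then in any permutation p, any two distinct very tight occurrences of q are disjoint; that is, if p has very tight occurrences of q at starting positions i < i', then i' - i ≥ k. -/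
/-- In a very tight occurrence the entries of the window are a translate of the pattern. -/
theorem IsVTO.exists_apply_eq_add {n k : ℕ} {p : Equiv.Perm (Fin n)} {q : Equiv.Perm (Fin k)}
    {i : ℕ} (h : IsVTO p q i) :
    ∃ hik : i + k ≤ n, ∃ a : ℕ, ∀ j : Fin k, (p ⟨i + j, by omega⟩ : ℕ) = a + q j := by
  obtain ⟨hik, a, -, hord, himg⟩ := h
  refine ⟨hik, a, fun j => ?_⟩
  have hmem (j : Fin k) : a ≤ (p ⟨i + j, by omega⟩ : ℕ) ∧ (p ⟨i + j, by omega⟩ : ℕ) < a + k := by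
    rw [← Finset.mem_Ico, ← himg]
    exact Finset.mem_image_of_mem _ (Finset.mem_univ j)
  let g : Fin k → Fin k := fun x =>
    ⟨(p ⟨i + (q.symm x : Fin k), by omega⟩ : ℕ) - a, by have := hmem (q.symm x); omega⟩
  have hg : StrictMono g := by
    intro x y hxy
    have h1 := (hord (q.symm x) (q.symm y)).1 (by simpa using hxy)
    have h2 := hmem (q.symm x)
    have h3 := hmem (q.symm y)
    rw [Fin.lt_def] at h1 ⊢
    simp only [g]
    omega
  have hid : g = id := (hg.range_inj strictMono_id).1 <| by
    rw [Set.range_id, (Finite.surjective_of_injective hg.injective).range_eq]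
  have hj := congrArg Fin.val (congrFun hid (q j))
  simp only [g, Equiv.symm_apply_apply, id] at hj
  have := hmem j
  omega

/-- If an injective function maps two overlapping intervals of length `k` onto intervals of
length `k`, then it preserves the distance between the left endpoints. -/
theorem Function.Injective.dist_eq_of_image_Ico {f : ℕ → ℕ} (hf : f.Injective)
    {i d k a b : ℕ} (hd : d < k)
    (h₁ : (Finset.Ico i (i + k)).image f = Finset.Ico a (a + k))
    (h₂ : (Finset.Ico (i + d) (i + d + k)).image f = Finset.Ico b (b + k)) :
    b = a + d ∨ a = b + d := by
  have h := congrArg Finset.card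
    (Finset.image_inter (Finset.Ico i (i + k)) (Finset.Ico (i + d) (i + d + k)) hf)
  rw [Finset.card_image_of_injective _ hf, h₁, h₂, Finset.Ico_inter_Ico, Finset.Ico_inter_Ico,
    Nat.card_Ico, Nat.card_Ico] at h
  omega

/-- If `q` (with first entry smaller than last entry) is non-condensible, then
any two distinct very tight occurrences of `q` in a permutation `p` are
disjoint: if they start at positions `i < i'` then `i' - i ≥ k`. -/
theorem stmt_4 {n k : ℕ} (hk : 0 < k) (q : Equiv.Perm (Fin k))
    (hq : q ⟨0, hk⟩ < q ⟨k - 1, by omega⟩) (hnc : ¬ Condensible q)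
    (p : Equiv.Perm (Fin n)) (i i' : ℕ) (h : i < i')
    (o1 : IsVTO p q i) (o2 : IsVTO p q i') :
    i + k ≤ i' := by
  obtain ⟨hin, a, ha⟩ := o1.exists_apply_eq_add
  obtain ⟨hin', b, hb⟩ := o2.exists_apply_eq_add
  by_contra! hlt
  obtain ⟨e, rfl⟩ := Nat.exists_eq_add_of_le h.le
  let f : ℕ → ℕ := fun m => if hm : m < n then (p ⟨m, hm⟩ : ℕ) else m
  have hf : f.Injective := by
    intro x y hxy
    simp only [f] at hxy
    split_ifs at hxy with hx hy hy
    · simpa using p.injective (Fin.ext hxy)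
    · omega
    · omega
    · exact hxy
  have himg (m c : ℕ) (hm : m + k ≤ n)
      (hc : ∀ j : Fin k, (p ⟨m + j, by omega⟩ : ℕ) = c + q j) :
      (Finset.Ico m (m + k)).image f = Finset.Ico c (c + k) := by
    apply Finset.eq_of_subset_of_card_le
    · intro v hv
      obtain ⟨x, hx, rfl⟩ := Finset.mem_image.1 hv
      rw [Finset.mem_Ico] at hx ⊢
      obtain ⟨y, rfl⟩ := Nat.exists_eq_add_of_le hx.1
      have := hc ⟨y, by omega⟩
      simp only at this
      simp only [f, dif_pos (show m + y < n by omega)]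
      have := (q ⟨y, by omega⟩).isLt
      omega
    · rw [Finset.card_image_of_injective _ hf, Nat.card_Ico, Nat.card_Ico]
      omega
  have hshift (j : ℕ) (hj : j + e < k) :
      a + (q ⟨j + e, hj⟩ : ℕ) = b + (q ⟨j, by omega⟩ : ℕ) := by
    rw [← ha, ← hb]
    congr 3
    simp only
    omega
  rcases hf.dist_eq_of_image_Ico (by omega) (himg _ _ hin ha) (himg _ _ hin' hb) with hab | hab
  · refine hnc ⟨k - e, by omega, by omega, fun j hj => ?_, fun j hj => ?_, fun j r hj hr => ?_⟩
    · have := hshift (j - e) (by omega)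
      simp only [show (j : ℕ) - e + e = j by omega, Fin.eta] at this
      omega
    · have hs := hshift j (by omega)
      have := (q ⟨j + e, by omega⟩).isLt
      rw [Fin.eta] at hs
      omega
    · have h1 := hshift j (by omega)
      have h2 := hshift r (by omega)
      simp only [show k - (k - e) = e by omega, Fin.lt_def]
      rw [Fin.eta] at h1 h2
      omega
  · have h0 := hshift 0 (by omega)
    rw [Fin.lt_def] at hq
    have hlast := hb ⟨k - 1, by omega⟩
    obtain ⟨j, hj⟩ := q.surjective ⟨q ⟨k - 1, by omega⟩ - e, by omega⟩
    have hj' := ha j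
    rw [hj] at hj'
    have := congrArg Fin.val (p.injective (Fin.ext (hlast.trans (show _ = _ by
      rw [hj']; simp only; omega))))
    simp only at this
    omega
end

section
/- Let k ≥ 2, i ≥ 1, and n ≥ k + i - 1, and let α = 12⋯k be the increasing pattern of length k. Then the number of permutations of length n having at least i very tight occurrences of α is at least (n - k - i + 2)!. -/
/-- The value sent to position `x` when the first entry of `σ` is inflated to an increasing
run of `l + 1` consecutive values. -/
def inflateVal {m : ℕ} (l : ℕ) (σ : Equiv.Perm (Fin (m + 1))) (x : ℕ) : ℕ :=
  if x ≤ l then σ 0 + x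
  else if h : x - l < m + 1 then
    if (σ ⟨x - l, h⟩ : ℕ) < σ 0 then σ ⟨x - l, h⟩ else σ ⟨x - l, h⟩ + l
  else 0

theorem inflateVal_of_le {m l : ℕ} (σ : Equiv.Perm (Fin (m + 1))) {x : ℕ} (h : x ≤ l) :
    inflateVal l σ x = σ 0 + x := if_pos h

theorem inflateVal_add {m : ℕ} (l : ℕ) (σ : Equiv.Perm (Fin (m + 1))) {y : Fin (m + 1)}
    (hy : y ≠ 0) : inflateVal l σ (y + l) = if (σ y : ℕ) < σ 0 then (σ y : ℕ) else σ y + l := by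
  have h : ¬ (y : ℕ) + l ≤ l := by
    have := Fin.val_ne_zero_iff.mpr hy
    omega
  simp [inflateVal, h, -Order.lt_add_one_iff]

theorem inflateVal_lt {m l : ℕ} (σ : Equiv.Perm (Fin (m + 1))) (x : ℕ) :
    inflateVal l σ x < m + l + 1 := by
  unfold inflateVal
  split_ifs <;> omega

theorem inflateVal_injOn {m l : ℕ} (σ : Equiv.Perm (Fin (m + 1))) :
    Set.InjOn (inflateVal l σ) (Set.Iio (m + l + 1)) := by
  have key {y : Fin (m + 1)} (hy : y ≠ 0) : (σ y : ℕ) ≠ σ 0 := fun h =>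
    hy (σ.injective (Fin.ext h))
  have decomp {x : ℕ} (hx : x < m + l + 1) (hl : l < x) :
      ∃ y : Fin (m + 1), y ≠ 0 ∧ x = y + l :=
    ⟨⟨x - l, by omega⟩, by simp [Fin.ext_iff]; omega, by simp; omega⟩
  intro x hx x' hx' h
  rw [Set.mem_Iio] at hx hx'
  rcases le_or_gt x l with hl | hl <;> rcases le_or_gt x' l with hl' | hl'
  · rw [inflateVal_of_le σ hl, inflateVal_of_le σ hl'] at h
    omega
  · obtain ⟨y, hy, rfl⟩ := decomp hx' hl'
    rw [inflateVal_of_le σ hl, inflateVal_add l σ hy] at h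
    have := key hy
    split_ifs at h <;> omega
  · obtain ⟨y, hy, rfl⟩ := decomp hx hl
    rw [inflateVal_of_le σ hl', inflateVal_add l σ hy] at h
    have := key hy
    split_ifs at h <;> omega
  · obtain ⟨y, hy, rfl⟩ := decomp hx hl
    obtain ⟨z, hz, rfl⟩ := decomp hx' hl'
    rw [inflateVal_add l σ hy, inflateVal_add l σ hz] at h
    have : y = z := by
      apply σ.injective
      ext
      split_ifs at h <;> omega
    rw [this]

/-- Inflating the first entry of `σ` to an increasing run of `l + 1` consecutive values. -/
noncomputable def inflate {m : ℕ} (l : ℕ) (σ : Equiv.Perm (Fin (m + 1))) :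
    Equiv.Perm (Fin (m + l + 1)) :=
  Equiv.ofBijective (fun x => ⟨inflateVal l σ x, inflateVal_lt σ x⟩) <|
    Finite.injective_iff_bijective.mp fun x y h =>
      Fin.ext (inflateVal_injOn σ x.isLt y.isLt (congrArg Fin.val h))

theorem val_inflate {m l : ℕ} (σ : Equiv.Perm (Fin (m + 1))) (x : Fin (m + l + 1)) :
    (inflate l σ x : ℕ) = inflateVal l σ x := rfl

theorem inflate_injective (m l : ℕ) :
    Function.Injective (inflate l : Equiv.Perm (Fin (m + 1)) → _) := by
  intro σ τ h
  have hv (x : ℕ) (hx : x < m + l + 1) : inflateVal l σ x = inflateVal l τ x := by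
    simpa only [val_inflate] using congrArg (fun p => (p ⟨x, hx⟩ : ℕ)) h
  have h0 : (σ 0 : ℕ) = τ 0 := by
    simpa [inflateVal_of_le] using hv 0 (by omega)
  ext y
  by_cases hy : y = 0
  · rw [hy, h0]
  · have := hv (y + l) (by omega)
    rw [inflateVal_add l σ hy, inflateVal_add l τ hy] at this
    split_ifs at this <;> omega

theorem isVTO_refl_of_val_eq_add {n k i a : ℕ} (p : Equiv.Perm (Fin n)) (hik : i + k ≤ n)
    (hak : a + k ≤ n)
    (h : ∀ x : Fin n, i ≤ x → (x : ℕ) < i + k → (p x : ℕ) + i = a + x) :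
    IsVTO p (Equiv.refl (Fin k)) i := by
  have h' (j : Fin k) : (p ⟨i + j, by omega⟩ : ℕ) = a + j := by
    have := h ⟨i + j, by omega⟩ (by simp) (by simp)
    simp only at this
    omega
  refine ⟨hik, a, hak, fun j r => ?_, ?_⟩
  · rw [Fin.lt_def, Fin.lt_def, h', h']
    simp
  · ext v
    simp only [h', Finset.mem_image, Finset.mem_univ, true_and, Finset.mem_Ico]
    constructor
    · rintro ⟨j, rfl⟩
      omega
    · rintro ⟨hv, hv'⟩
      exact ⟨⟨v - a, by omega⟩, by simp only; omega⟩

theorem le_numVTO {n k i : ℕ} {p : Equiv.Perm (Fin n)} {q : Equiv.Perm (Fin k)}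
    (h : ∀ j < i, IsVTO p q j) : i ≤ numVTO p q := by
  have hfin : {j : ℕ | IsVTO p q j}.Finite :=
    (Set.finite_Iic n).subset fun j ⟨hj, _⟩ => Set.mem_Iic.mpr (by omega)
  have hsub : (Finset.range i : Set ℕ) ⊆ {j : ℕ | IsVTO p q j} := fun j hj =>
    h j (by simpa using hj)
  calc i = (Finset.range i : Set ℕ).ncard := by rw [Set.ncard_coe_finset, Finset.card_range]
    _ ≤ numVTO p q := Set.ncard_le_ncard hsub hfin

theorem le_numVTO_inflate {m l k i : ℕ} (σ : Equiv.Perm (Fin (m + 1))) (h : k + i ≤ l + 2) :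
    i ≤ numVTO (inflate l σ) (Equiv.refl (Fin k)) :=
  le_numVTO fun j hj =>
    isVTO_refl_of_val_eq_add (a := σ 0 + j) _ (by omega) (by omega) fun x _ hx => by
      rw [val_inflate, inflateVal_of_le σ (by omega)]
      omega

/-- Let `k ≥ 2`, `i ≥ 1`, `n ≥ k + i - 1`, and let `α = 12⋯k` be the increasing
pattern of length `k` (the identity permutation). Then the number of
`n`-permutations with at least `i` very tight occurrences of `α` is at least
`(n - k - i + 2)!`. -/
theorem stmt_8 {n k : ℕ} (i : ℕ) (hk : 2 ≤ k) (hi : 1 ≤ i) (hn : k + i - 1 ≤ n) :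
    Nat.factorial (n + 2 - k - i)
      ≤ Nat.card {p : Equiv.Perm (Fin n) // i ≤ numVTO p (Equiv.refl (Fin k))} := by
  obtain ⟨l, hl⟩ : ∃ l, k + i = l + 2 := ⟨k + i - 2, by omega⟩
  obtain ⟨m, rfl⟩ : ∃ m, n = m + l + 1 := ⟨n - l - 1, by omega⟩
  have hm : m + l + 1 + 2 - k - i = m + 1 := by omega
  calc (m + l + 1 + 2 - k - i).factorial = Nat.card (Equiv.Perm (Fin (m + 1))) := by
        rw [hm, Nat.card_perm, Nat.card_fin]
    _ ≤ _ := Nat.card_le_card_of_injective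
        (fun σ => ⟨inflate l σ, le_numVTO_inflate σ hl.le⟩)
        fun _ _ h => inflate_injective m l (congrArg Subtype.val h)
end

section
/- Let k ≥ 3, let q = q_1 q_2 ⋯ q_k be a non-condensible permutation of length k with q_1 < q_k, let α = 12⋯k, and let i ≥ 2. Then for every n, the number of permutations of length n having at least i very tight occurrences of q is at most the number of permutations of length n having at least i very tight occurrences of α. -/
namespace VeryTight

open Finset

/-- A permutation of `Fin n`, extended by the identity to a function on `ℕ`. -/
def val {n : ℕ} (p : Equiv.Perm (Fin n)) (x : ℕ) : ℕ :=
  if h : x < n then (p ⟨x, h⟩ : ℕ) else x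

theorem val_of_lt {n : ℕ} (p : Equiv.Perm (Fin n)) {x : ℕ} (h : x < n) :
    val p x = (p ⟨x, h⟩ : ℕ) := by
  simp [val, h]

theorem val_lt {n : ℕ} (p : Equiv.Perm (Fin n)) {x : ℕ} (h : x < n) : val p x < n := by
  rw [val_of_lt p h]; exact (p ⟨x, h⟩).isLt

theorem val_injective {n : ℕ} (p : Equiv.Perm (Fin n)) : Function.Injective (val p) := by
  intro x y hxy
  by_cases hx : x < n <;> by_cases hy : y < n
  · rw [val_of_lt p hx, val_of_lt p hy] at hxy
    simpa using p.injective (Fin.ext hxy)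
  · have := val_lt p hx
    simp only [val, hy, dif_neg, not_false_eq_true] at hxy this
    omega
  · have := val_lt p hy
    simp only [val, hx, dif_neg, not_false_eq_true] at hxy this
    omega
  · simpa [val, hx, hy] using hxy

theorem perm_eq_of_lt_iff {n : ℕ} {p p' : Equiv.Perm (Fin n)}
    (h : ∀ x y : Fin n, p x < p y ↔ p' x < p' y) : p = p' := by
  have hle (x y : Fin n) : p x ≤ p y ↔ p' x ≤ p' y := by
    rw [← not_lt, ← not_lt, h]
  let e : Fin n ≃o Fin n :=
    { toEquiv := p.symm.trans p'
      map_rel_iff' := by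
        intro a b
        simpa using (hle (p.symm a) (p.symm b)).symm }
  have he : e = OrderIso.refl _ := Subsingleton.elim _ _
  ext x
  have := congrArg (fun f : Fin n ≃o Fin n => (f (p x) : ℕ)) he
  simpa [e] using this.symm

theorem isVTO_iff {n k : ℕ} (hk : 0 < k) (p : Equiv.Perm (Fin n)) (q : Equiv.Perm (Fin k))
    (s : ℕ) :
    IsVTO p q s ↔ s + k ≤ n ∧ ∃ a, ∀ t : Fin k, val p (s + t) = a + q t := by
  constructor
  · rintro ⟨hs, a, -, hiff, himg⟩
    refine ⟨hs, a, ?_⟩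
    have hmem (t : Fin k) : (p ⟨s + t, by omega⟩ : ℕ) ∈ Finset.Ico a (a + k) := by
      rw [← himg]; exact mem_image_of_mem _ (mem_univ t)
    let f : Fin k → Fin k := fun t => ⟨(p ⟨s + t, by omega⟩ : ℕ) - a, by
      have := mem_Ico.1 (hmem t); omega⟩
    have hf : Function.Injective f := by
      intro t r htr
      have h1 := mem_Ico.1 (hmem t)
      have h2 := mem_Ico.1 (hmem r)
      have h3 : (p ⟨s + t, by omega⟩ : ℕ) - a = (p ⟨s + r, by omega⟩ : ℕ) - a :=
        congrArg Fin.val htr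
      have h4 := p.injective (Fin.ext (show (p ⟨s + t, by omega⟩ : ℕ)
        = (p ⟨s + r, by omega⟩ : ℕ) by omega))
      exact Fin.ext (by simpa using h4)
    have he : q = Equiv.ofBijective f (Finite.injective_iff_bijective.1 hf) := by
      refine perm_eq_of_lt_iff fun x y => (hiff x y).trans ?_
      have h1 := mem_Ico.1 (hmem x)
      have h2 := mem_Ico.1 (hmem y)
      simp only [Equiv.ofBijective_apply, f, Fin.lt_def]
      omega
    intro t
    have h1 := mem_Ico.1 (hmem t)
    rw [val_of_lt p (by omega), he]
    simp only [Equiv.ofBijective_apply, f]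
    omega
  · rintro ⟨hs, a, ha⟩
    have ha' (t : Fin k) : (p ⟨s + t, by omega⟩ : ℕ) = a + q t := by
      rw [← ha t, val_of_lt p (by omega)]
    refine ⟨hs, a, ?_, ?_, ?_⟩
    · have h1 := ha' (q.symm ⟨k - 1, by omega⟩)
      have h2 := (p ⟨s + (q.symm ⟨k - 1, by omega⟩ : Fin k), by omega⟩).isLt
      rw [h1] at h2
      simp at h2
      omega
    · intro j r
      rw [Fin.lt_def, Fin.lt_def, ha', ha']
      omega
    · ext v
      simp only [mem_image, mem_univ, true_and, mem_Ico, ha']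
      constructor
      · rintro ⟨t, rfl⟩; omega
      · rintro ⟨h1, h2⟩
        exact ⟨q.symm ⟨v - a, by omega⟩, by simp; omega⟩

/-- The values in the interval of a very tight occurrence are exactly those in its window. -/
theorem val_mem_iff {n k : ℕ} {p : Equiv.Perm (Fin n)} {q : Equiv.Perm (Fin k)} {s a : ℕ}
    (h : ∀ t : Fin k, val p (s + t) = a + q t) (x : ℕ) :
    (a ≤ val p x ∧ val p x < a + k) ↔ (s ≤ x ∧ x < s + k) := by
  constructor
  · rintro ⟨h1, h2⟩
    have h3 := h (q.symm ⟨val p x - a, by omega⟩)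
    rw [Equiv.apply_symm_apply] at h3
    have h4 := val_injective p (h3.trans (show _ = val p x by simp only; omega))
    have := (q.symm ⟨val p x - a, by omega⟩).isLt
    omega
  · rintro ⟨h1, h2⟩
    have h3 := h ⟨x - s, by omega⟩
    have h4 : s + (x - s) = x := by omega
    simp only [h4] at h3
    omega

theorem eq_of_lt_iff_lt {k x y : ℕ} (q : Equiv.Perm (Fin k)) (hx : x ≤ k) (hy : y ≤ k)
    (h : ∀ j : Fin k, (q j : ℕ) < x ↔ (j : ℕ) < y) : x = y := by
  have h1 : (univ.filter fun j : Fin k => (j : ℕ) < x).card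
      = (univ.filter fun j : Fin k => (j : ℕ) < y).card := by
    refine card_bij (fun j _ => q.symm j) ?_ (by simp) ?_
    · intro j hj
      simpa [← h] using hj
    · intro j hj
      exact ⟨q j, by simpa [h] using hj, by simp⟩
  simpa [Fin.card_filter_val_lt, hx, hy] using h1

/-- Very tight occurrences of a non-condensible pattern with `q_1 < q_k` do not overlap. -/
theorem add_le_of_isVTO {n k : ℕ} (hk : 0 < k) {q : Equiv.Perm (Fin k)}
    (hq : q ⟨0, by omega⟩ < q ⟨k - 1, by omega⟩) (hnc : ¬ Condensible q)
    {p : Equiv.Perm (Fin n)} {s t : ℕ} (hs : IsVTO p q s) (ht : IsVTO p q t) (hst : s < t) :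
    s + k ≤ t := by
  obtain ⟨-, a, ha⟩ := (isVTO_iff hk p q s).1 hs
  obtain ⟨-, b, hb⟩ := (isVTO_iff hk p q t).1 ht
  by_contra! hlt
  rcases le_or_gt a b with hab | hab
  · have hiff (j : Fin k) : (q j : ℕ) < k - (b - a) ↔ (j : ℕ) < k - (t - s) := by
      have h1 := val_mem_iff ha (t + j)
      rw [hb j] at h1
      omega
    have he := eq_of_lt_iff_lt q (by omega) (by omega) hiff
    have h0 := (hiff ⟨0, hk⟩).2 (by simp only; omega)
    have hd : b - a = t - s := by omega
    have hshift (j : ℕ) (hj : j < k - (t - s)) :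
        (q ⟨j + (t - s), by omega⟩ : ℕ) = q ⟨j, by omega⟩ + (t - s) := by
      have h1 := ha ⟨j + (t - s), by omega⟩
      have h2 := hb ⟨j, by omega⟩
      have h3 : s + (j + (t - s)) = t + j := by omega
      simp only [h3] at h1 h2
      omega
    refine hnc ⟨k - (t - s), by omega, by omega, ?_, ?_, ?_⟩
    · intro j hj
      have h1 := hshift (j - (t - s)) (by omega)
      have h2 : (⟨(j : ℕ) - (t - s) + (t - s), by omega⟩ : Fin k) = j := Fin.ext (by simp only; omega)
      rw [h2] at h1
      omega
    · intro j hj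
      have := (hiff j).2 hj
      omega
    · intro j r hj hr
      have h1 := hshift j hj
      have h2 := hshift r hr
      have h3 : k - (k - (t - s)) = t - s := by omega
      simp only [h3, Fin.lt_def, h1, h2, Fin.eta]
      omega
  · have hiff (j : Fin k) : (q j : ℕ) < k - (a - b) ↔ t - s ≤ (j : ℕ) := by
      have h1 := val_mem_iff hb (s + j)
      rw [ha j] at h1
      omega
    have h0 := hiff ⟨0, by omega⟩
    have h1 := hiff ⟨k - 1, by omega⟩
    rw [Fin.lt_def] at hq
    simp only at h0 h1
    omega

theorem exists_equiv_lt_iff {K : Finset ℕ} {f : ℕ → ℕ} (hf : Function.Injective f) :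
    ∃ e : K ≃ Fin K.card, ∀ x y : K, e x < e y ↔ f x < f y := by
  have hc : (K.image f).card = K.card := card_image_of_injective K hf
  let o := (K.image f).orderIsoOfFin hc
  let g : K → (K.image f : Finset ℕ) := fun x => ⟨f x, mem_image_of_mem f x.2⟩
  have hg : Function.Bijective g := by
    constructor
    · intro x y hxy
      exact Subtype.ext (hf (congrArg Subtype.val hxy))
    · rintro ⟨v, hv⟩
      obtain ⟨x, hx, rfl⟩ := mem_image.1 hv
      exact ⟨⟨x, hx⟩, rfl⟩
  refine ⟨(Equiv.ofBijective g hg).trans o.symm.toEquiv, fun x y => ?_⟩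
  simp [g]

/-- Comparisons with entries outside a very tight occurrence see only its first entry. -/
theorem val_lt_val_iff_of_isVTO {n k : ℕ} (hk : 0 < k) {p : Equiv.Perm (Fin n)}
    {q : Equiv.Perm (Fin k)} {s x y : ℕ} (h : IsVTO p q s) (hx : s ≤ x ∧ x < s + k)
    (hy : ¬(s ≤ y ∧ y < s + k)) :
    (val p x < val p y ↔ val p s < val p y) ∧ (val p y < val p x ↔ val p y < val p s) := by
  obtain ⟨-, a, ha⟩ := (isVTO_iff hk p q s).1 h
  have h1 := (val_mem_iff ha x).2 hx
  have h2 := (val_mem_iff ha s).2 ⟨le_rfl, by omega⟩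
  have h3 := (val_mem_iff ha y).not.2 hy
  omega

theorem val_lt_val_iff_of_mem {n k : ℕ} (hk : 0 < k) {p : Equiv.Perm (Fin n)}
    {q : Equiv.Perm (Fin k)} {s x y : ℕ} (h : IsVTO p q s) (hx : s ≤ x ∧ x < s + k)
    (hy : s ≤ y ∧ y < s + k) :
    val p x < val p y ↔ q ⟨x - s, by omega⟩ < q ⟨y - s, by omega⟩ := by
  obtain ⟨-, a, ha⟩ := (isVTO_iff hk p q s).1 h
  have h1 := ha ⟨x - s, by omega⟩
  have h2 := ha ⟨y - s, by omega⟩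
  have h3 : s + (x - s) = x := by omega
  have h4 : s + (y - s) = y := by omega
  simp only [h3, h4] at h1 h2
  rw [h1, h2, Fin.lt_def]
  omega

open Classical in
/-- At most `(n - |S| (k - 1))!` permutations have very tight occurrences of `q` at all
positions of a set `S` of disjoint windows. -/
theorem card_isVTO_le {n k : ℕ} (hk : 0 < k) (q : Equiv.Perm (Fin k)) (S : Finset ℕ)
    (hS : ∀ s ∈ S, ∀ t ∈ S, s < t → s + k ≤ t) :
    (univ.filter fun p : Equiv.Perm (Fin n) => ∀ s ∈ S, IsVTO p q s).card
      ≤ (n - S.card * (k - 1)).factorial := by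
  rcases (univ.filter fun p : Equiv.Perm (Fin n) => ∀ s ∈ S, IsVTO p q s).eq_empty_or_nonempty
    with hE | ⟨p₀, hp₀⟩
  · simp [hE]
  have hSn : ∀ s ∈ S, s + k ≤ n := fun s hs =>
    ((isVTO_iff hk _ _ _).1 ((mem_filter.1 hp₀).2 s hs)).1
  set B := S.biUnion fun s => Ioo s (s + k) with hB
  have hBcard : B.card = S.card * (k - 1) := by
    rw [hB, card_biUnion]
    · simp
    · intro s hs t ht hst
      refine disjoint_left.2 fun x h1 h2 => ?_
      rw [mem_Ioo] at h1 h2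
      have h3 := hS s hs t ht
      have h4 := hS t ht s hs
      omega
  have hBn : B ⊆ range n := by
    intro x hx
    obtain ⟨s, hs, hx⟩ := mem_biUnion.1 hx
    have := hSn s hs
    rw [mem_Ioo] at hx
    exact mem_range.2 (by omega)
  set K := range n \ B with hK
  have hKcard : K.card = n - S.card * (k - 1) := by
    rw [hK, card_sdiff_of_subset hBn, hBcard, card_range]
  choose e he using fun p : Equiv.Perm (Fin n) => exists_equiv_lt_iff (K := K) (val_injective p)
  have hmap : (univ.filter fun p : Equiv.Perm (Fin n) => ∀ s ∈ S, IsVTO p q s).card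
      ≤ (univ : Finset (K ≃ Fin K.card)).card := by
    refine card_le_card_of_injOn e (fun _ _ => mem_univ _) ?_
    intro p hp p' hp' hpp
    have hp : ∀ s ∈ S, IsVTO p q s := (mem_filter.1 hp).2
    have hp' : ∀ s ∈ S, IsVTO p' q s := (mem_filter.1 hp').2
    have hKK : ∀ x ∈ K, ∀ y ∈ K, val p x < val p y ↔ val p' x < val p' y := by
      intro x hx y hy
      rw [← he p ⟨x, hx⟩ ⟨y, hy⟩, hpp, he p' ⟨x, hx⟩ ⟨y, hy⟩]
    let common : ℕ → ℕ → Prop := fun x y =>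
      ∃ s ∈ S, (s ≤ x ∧ x < s + k) ∧ (s ≤ y ∧ y < s + k)
    have hrep : ∀ x < n, ∀ y, ¬ common x y → ∃ x₀ ∈ K, ¬ common x₀ y ∧
        ∀ r : Equiv.Perm (Fin n), (∀ s ∈ S, IsVTO r q s) →
          (val r x < val r y ↔ val r x₀ < val r y) ∧
          (val r y < val r x ↔ val r y < val r x₀) := by
      intro x hx y hxy
      by_cases hb : ∃ s ∈ S, s ≤ x ∧ x < s + k
      · obtain ⟨s, hs, hsx⟩ := hb
        have hy : ¬(s ≤ y ∧ y < s + k) := fun hy => hxy ⟨s, hs, hsx, hy⟩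
        refine ⟨s, ?_, ?_, fun r hr => val_lt_val_iff_of_isVTO hk (hr s hs) hsx hy⟩
        · refine mem_sdiff.2 ⟨mem_range.2 (by have := hSn s hs; omega), fun h => ?_⟩
          obtain ⟨t, ht, h⟩ := mem_biUnion.1 h
          rw [mem_Ioo] at h
          have := hS t ht s hs h.1
          omega
        · rintro ⟨t, ht, h1, h2⟩
          rcases h1.1.lt_or_eq with h | rfl
          · have := hS t ht s hs h
            omega
          · exact hy h2
      · refine ⟨x, mem_sdiff.2 ⟨mem_range.2 hx, fun h => ?_⟩, hxy, fun r _ => ⟨Iff.rfl, Iff.rfl⟩⟩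
        obtain ⟨t, ht, h⟩ := mem_biUnion.1 h
        rw [mem_Ioo] at h
        exact hb ⟨t, ht, by omega, by omega⟩
    refine perm_eq_of_lt_iff fun x y => ?_
    rw [Fin.lt_def, Fin.lt_def]
    have hv (r : Equiv.Perm (Fin n)) (z : Fin n) : (r z : ℕ) = val r z := by
      rw [val_of_lt r z.isLt]
    rw [hv, hv, hv, hv]
    by_cases hc : common x y
    · obtain ⟨s, hs, h1, h2⟩ := hc
      rw [val_lt_val_iff_of_mem hk (hp s hs) h1 h2, val_lt_val_iff_of_mem hk (hp' s hs) h1 h2]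
    · obtain ⟨x₀, hx₀, hc₁, hX⟩ := hrep x x.isLt y hc
      obtain ⟨y₀, hy₀, -, hY⟩ := hrep y y.isLt x₀
        (fun ⟨s, hs, h1, h2⟩ => hc₁ ⟨s, hs, h2, h1⟩)
      rw [(hX p hp).1, (hX p' hp').1, (hY p hp).2, (hY p' hp').2, hKK x₀ hx₀ y₀ hy₀]
  refine hmap.trans ?_
  rw [card_univ, Fintype.card_equiv K.equivFin, Fintype.card_coe, hKcard]

/-- Replace the entry of `σ` at position `j` by an increasing run of `D + 1` consecutive values. -/
def inflate {N : ℕ} (σ : Equiv.Perm (Fin N)) (D j x : ℕ) : ℕ :=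
  if j ≤ x ∧ x ≤ j + D then val σ j + (x - j)
  else if val σ (if x < j then x else x - D) < val σ j then val σ (if x < j then x else x - D)
  else val σ (if x < j then x else x - D) + D

theorem inflate_injective {N : ℕ} (σ : Equiv.Perm (Fin N)) (D j : ℕ) :
    Function.Injective (inflate σ D j) := by
  intro x y hxy
  have hσ (u v : ℕ) (h : val σ u = val σ v) : u = v := val_injective σ h
  have h1 := hσ (if x < j then x else x - D) (if y < j then y else y - D)
  have h2 := hσ (if x < j then x else x - D) j
  have h3 := hσ (if y < j then y else y - D) j
  unfold inflate at hxy
  split_ifs at * <;> omega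

theorem inflate_lt {N : ℕ} (σ : Equiv.Perm (Fin N)) {D j x : ℕ} (hj : j < N) (hx : x < N + D) :
    inflate σ D j x < N + D := by
  have h1 := val_lt σ hj
  have h2 : (if x < j then x else x - D) < N ∨ (j ≤ x ∧ x ≤ j + D) := by split_ifs <;> omega
  unfold inflate
  split_ifs with h
  · omega
  all_goals
    have := val_lt σ (h2.resolve_right h)
    split_ifs at *
    omega

theorem val_eq_of_inflate_eq {N : ℕ} {σ σ' : Equiv.Perm (Fin N)} {D j : ℕ} (hj : j < N)
    (h : ∀ x < N + D, inflate σ D j x = inflate σ' D j x) : ∀ y < N, val σ y = val σ' y := by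
  intro y hy
  have h0 := h j (by omega)
  simp only [inflate, le_refl, Nat.le_add_right, and_self, if_true] at h0
  rcases lt_trichotomy y j with hyj | rfl | hyj
  · have h1 := h y (by omega)
    simp only [inflate, hyj, if_true, show ¬(j ≤ y ∧ y ≤ j + D) by omega, if_false] at h1
    split_ifs at h1 <;> omega
  · omega
  · have h1 := h (y + D) (by omega)
    simp only [inflate, show ¬(y + D < j) by omega, show ¬(j ≤ y + D ∧ y + D ≤ j + D) by omega,
      if_false, Nat.add_sub_cancel] at h1
    split_ifs at h1 <;> omega

open Classical in
theorem factorial_le_card_isVTO_refl {N D j : ℕ} (hj : j < N) :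
    N.factorial ≤ (univ.filter fun p : Equiv.Perm (Fin (N + D)) =>
      IsVTO p (Equiv.refl (Fin (D + 1))) j).card := by
  let f : Equiv.Perm (Fin N) → Equiv.Perm (Fin (N + D)) := fun σ =>
    Equiv.ofBijective (fun x => ⟨inflate σ D j x, inflate_lt σ hj x.isLt⟩)
      (Finite.injective_iff_bijective.1 fun x y hxy =>
        Fin.ext (inflate_injective σ D j (congrArg Fin.val hxy)))
  have hf (σ : Equiv.Perm (Fin N)) (x : ℕ) (hx : x < N + D) :
      val (f σ) x = inflate σ D j x := by
    rw [val_of_lt _ hx]; rfl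
  have hcard : (univ : Finset (Equiv.Perm (Fin N))).card = N.factorial := by
    rw [card_univ, Fintype.card_perm, Fintype.card_fin]
  rw [← hcard]
  refine card_le_card_of_injOn f (fun σ _ => ?_) fun σ _ σ' _ hσ => ?_
  · simp only [coe_filter, mem_univ, true_and, Set.mem_ofPred_eq]
    refine (isVTO_iff (by omega) _ _ _).2 ⟨by omega, val σ j, fun t => ?_⟩
    rw [hf _ _ (by omega), inflate, if_pos (by omega), Equiv.refl_apply]
    omega
  · have h := val_eq_of_inflate_eq (σ := σ) (σ' := σ') hj (D := D) fun x hx => by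
      rw [← hf σ x hx, ← hf σ' x hx, hσ]
    ext y
    simpa [val_of_lt] using h y y.isLt

/-- Two overlapping runs of consecutive increasing values merge into a longer run. -/
theorem isVTO_refl_succ {n D s t : ℕ} {p : Equiv.Perm (Fin n)}
    (hs : IsVTO p (Equiv.refl (Fin (D + 1))) s) (ht : IsVTO p (Equiv.refl (Fin (D + 1))) t)
    (hst : s < t) (hts : t ≤ s + D) : IsVTO p (Equiv.refl (Fin (D + 2))) (t - 1) := by
  obtain ⟨-, a, ha⟩ := (isVTO_iff (by omega) _ _ _).1 hs
  obtain ⟨htn, b, hb⟩ := (isVTO_iff (by omega) _ _ _).1 ht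
  have h1 := ha ⟨t - 1 - s, by omega⟩
  have h2 := ha ⟨t - s, by omega⟩
  have h3 := hb ⟨0, by omega⟩
  have e1 : s + (t - 1 - s) = t - 1 := by omega
  have e2 : s + (t - s) = t := by omega
  simp only [Equiv.refl_apply, e1, e2, Nat.add_zero] at h1 h2 h3
  refine (isVTO_iff (by omega) _ _ _).2 ⟨by omega, b - 1, fun u => ?_⟩
  rw [Equiv.refl_apply]
  by_cases hu : (u : ℕ) = 0
  · rw [hu, Nat.add_zero, h1]
    omega
  · have h4 := hb ⟨u - 1, by omega⟩
    have e3 : t + ((u : ℕ) - 1) = t - 1 + u := by omega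
    simp only [Equiv.refl_apply, e3] at h4
    omega

open Classical in
theorem card_overlap_le {N D j : ℕ} (hD : 2 ≤ D) (hj : j < N) :
    (univ.filter fun p : Equiv.Perm (Fin (N + D)) =>
      IsVTO p (Equiv.refl (Fin (D + 1))) j ∧
        ∃ s < j, IsVTO p (Equiv.refl (Fin (D + 1))) s).card ≤ 2 * (N - 1).factorial := by
  let A := univ.filter fun p : Equiv.Perm (Fin (N + D)) =>
    ∀ s ∈ ({j - 1} : Finset ℕ), IsVTO p (Equiv.refl (Fin (D + 2))) s
  let B : ℕ → Finset (Equiv.Perm (Fin (N + D))) := fun i => univ.filter fun p =>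
    ∀ s ∈ ({i, j} : Finset ℕ), IsVTO p (Equiv.refl (Fin (D + 1))) s
  have hA : A.card ≤ (N - 1).factorial := by
    refine (card_isVTO_le (by omega) _ _ (by simp)).trans_eq ?_
    congr 1
    rw [card_singleton]
    omega
  have hB : ∀ i ∈ range (j - D), (B i).card ≤ (N - D).factorial := by
    intro i hi
    rw [mem_range] at hi
    refine (card_isVTO_le (by omega) _ _ ?_).trans_eq ?_
    · simp only [mem_insert, mem_singleton]
      omega
    · congr 1
      rw [card_pair (by omega)]
      omega
  have hsub : (univ.filter fun p : Equiv.Perm (Fin (N + D)) =>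
      IsVTO p (Equiv.refl (Fin (D + 1))) j ∧
        ∃ s < j, IsVTO p (Equiv.refl (Fin (D + 1))) s) ⊆ A ∪ (range (j - D)).biUnion B := by
    intro p hp
    obtain ⟨hpj, s, hsj, hps⟩ := (mem_filter.1 hp).2
    rw [mem_union, mem_biUnion]
    rcases le_or_gt j (s + D) with h | h
    · exact Or.inl (mem_filter.2 ⟨mem_univ _, by simpa using isVTO_refl_succ hps hpj hsj h⟩)
    · refine Or.inr ⟨s, mem_range.2 (by omega), mem_filter.2 ⟨mem_univ _, ?_⟩⟩
      simpa using ⟨hps, hpj⟩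
  refine (card_le_card hsub).trans ((card_union_le _ _).trans ?_)
  have h1 := card_biUnion_le_card_mul _ _ _ hB
  rw [card_range] at h1
  have h2 : (j - D) * (N - D).factorial ≤ (N - 1).factorial := by
    rcases Nat.le_total j D with h | h
    · simp [Nat.sub_eq_zero_of_le h]
    · calc (j - D) * (N - D).factorial ≤ (N - D + 1) * (N - D).factorial :=
            Nat.mul_le_mul_right _ (by omega)
        _ = (N - D + 1).factorial := (Nat.factorial_succ _).symm
        _ ≤ (N - 1).factorial := Nat.factorial_le (by omega)
  omega

open Classical in
theorem mul_factorial_le_card_exists_isVTO_refl {N D : ℕ} (hD : 2 ≤ D) :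
    (N - 2) * N.factorial ≤ (univ.filter fun p : Equiv.Perm (Fin (N + D)) =>
      ∃ j < N, IsVTO p (Equiv.refl (Fin (D + 1))) j).card := by
  let E : ℕ → Finset (Equiv.Perm (Fin (N + D))) := fun j => univ.filter fun p =>
    IsVTO p (Equiv.refl (Fin (D + 1))) j ∧ ¬ ∃ s < j, IsVTO p (Equiv.refl (Fin (D + 1))) s
  have hE : ∀ j ∈ range N, N.factorial - 2 * (N - 1).factorial ≤ (E j).card := by
    intro j hj
    rw [mem_range] at hj
    have h1 := factorial_le_card_isVTO_refl (D := D) hj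
    have h2 := card_overlap_le hD hj
    have h3 := card_filter_add_card_filter_not (s := univ.filter
      fun p : Equiv.Perm (Fin (N + D)) => IsVTO p (Equiv.refl (Fin (D + 1))) j)
      fun p => ∃ s < j, IsVTO p (Equiv.refl (Fin (D + 1))) s
    rw [filter_filter, filter_filter] at h3
    change _ + (E j).card = _ at h3
    omega
  have hdisj : ((range N : Finset ℕ) : Set ℕ).PairwiseDisjoint E := by
    intro i _ j _ hij
    refine disjoint_left.2 fun p h1 h2 => ?_
    have h1 := (mem_filter.1 h1).2
    have h2 := (mem_filter.1 h2).2
    rcases hij.lt_or_gt with h | h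
    · exact h2.2 ⟨i, h, h1.1⟩
    · exact h1.2 ⟨j, h, h2.1⟩
  calc (N - 2) * N.factorial = N * (N.factorial - 2 * (N - 1).factorial) := by
        rcases N with _ | N
        · simp
        · rw [Nat.add_sub_cancel, Nat.factorial_succ, ← Nat.sub_mul, ← Nat.mul_assoc,
            ← Nat.mul_assoc, Nat.mul_comm (N + 1)]
    _ ≤ ∑ j ∈ range N, (E j).card := by
        simpa using card_nsmul_le_sum _ _ _ hE
    _ = ((range N).biUnion E).card := (card_biUnion hdisj).symm
    _ ≤ _ := by
        refine card_le_card fun p hp => ?_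
        obtain ⟨j, hj, hp⟩ := mem_biUnion.1 hp
        exact mem_filter.2 ⟨mem_univ _, j, mem_range.1 hj, (mem_filter.1 hp).2.1⟩

theorem finite_setOf_isVTO {n k : ℕ} (p : Equiv.Perm (Fin n)) (q : Equiv.Perm (Fin k)) :
    {s | IsVTO p q s}.Finite :=
  (Set.finite_Iic n).subset fun s hs => by
    have := hs.1
    simp only [Set.mem_Iic]
    omega

/-- A run of `k + i - 1` consecutive increasing values contains `i` occurrences of `12⋯k`. -/
theorem le_numVTO_refl {n k i D j : ℕ} (hk : 0 < k) (hD : D + 2 = k + i)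
    {p : Equiv.Perm (Fin n)} (h : IsVTO p (Equiv.refl (Fin (D + 1))) j) :
    i ≤ numVTO p (Equiv.refl (Fin k)) := by
  obtain ⟨hn, a, ha⟩ := (isVTO_iff (by omega) _ _ _).1 h
  have hsub : ((Ico j (j + i) : Finset ℕ) : Set ℕ) ⊆ {s | IsVTO p (Equiv.refl (Fin k)) s} := by
    intro s hs
    rw [coe_Ico, Set.mem_Ico] at hs
    refine (isVTO_iff hk _ _ _).2 ⟨by omega, a + (s - j), fun t => ?_⟩
    have h1 := ha ⟨s - j + t, by omega⟩
    have e : j + (s - j + t) = s + t := by omega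
    simp only [Equiv.refl_apply, e] at h1 ⊢
    omega
  have := Set.ncard_le_ncard hsub (finite_setOf_isVTO _ _)
  rwa [Set.ncard_coe_finset, Nat.card_Ico, Nat.add_sub_cancel_left] at this

theorem mul_add_le_of_gap {i k : ℕ} {e : Fin i → ℕ} (he : ∀ a b, a < b → e a + k ≤ e b)
    {a b : Fin i} (hab : a ≤ b) : e a + (b - a : ℕ) * k ≤ e b := by
  obtain ⟨b, hb⟩ := b
  induction b with
  | zero =>
    have : a = ⟨0, hb⟩ := le_antisymm hab (Nat.zero_le _)
    simp [this]
  | succ b ih =>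
    rcases hab.lt_or_eq with h | rfl
    · have hab' : a ≤ ⟨b, by omega⟩ := Nat.lt_succ_iff.1 h
      have h1 := ih (by omega) hab'
      have h2 := he ⟨b, by omega⟩ ⟨b + 1, hb⟩ (Nat.lt_succ_self b)
      have h3 : b + 1 - (a : ℕ) = b - a + 1 := by
        have : (a : ℕ) ≤ b := hab'
        omega
      simp only [h3, Nat.add_mul, one_mul] at h1 ⊢
      omega
    · simp

/-- The positions of `i` disjoint windows of length `k` in `n` letters, obtained by spreading out
`i` of `n - i (k - 1)` letters. -/
theorem exists_embedding_of_gap {n k i : ℕ} (hk : 0 < k) {S : Finset ℕ} (hScard : S.card = i)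
    (hS : ∀ s ∈ S, ∀ t ∈ S, s < t → s + k ≤ t) (hSn : ∀ s ∈ S, s + k ≤ n) :
    ∃ h : Fin i ↪ Fin (n - i * (k - 1)),
      S = univ.image fun j : Fin i => (h j : ℕ) + j * (k - 1) := by
  let e := S.orderEmbOfFin hScard
  have hgap : ∀ a b, a < b → e a + k ≤ e b := fun a b hab =>
    hS _ (S.orderEmbOfFin_mem hScard a) _ (S.orderEmbOfFin_mem hScard b) (e.strictMono hab)
  obtain ⟨k, rfl⟩ : ∃ k', k = k' + 1 := ⟨k - 1, by omega⟩
  rw [Nat.add_sub_cancel]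
  have hlow (a : Fin i) : (a : ℕ) * k ≤ e a := by
    have h1 := mul_add_le_of_gap hgap (show (⟨0, a.pos⟩ : Fin i) ≤ a from Nat.zero_le _)
    simp only [Nat.sub_zero, Nat.mul_add, mul_one] at h1
    omega
  have hup (a : Fin i) : e a - a * k < n - i * k := by
    have h1 := mul_add_le_of_gap hgap
      (show a ≤ (⟨i - 1, by have := a.isLt; omega⟩ : Fin i) from Nat.le_pred_of_lt a.isLt)
    have h2 := hSn _ (S.orderEmbOfFin_mem hScard ⟨i - 1, by have := a.isLt; omega⟩)
    have h3 : i * k = a * k + (i - 1 - a) * k + k := by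
      rw [← Nat.add_mul, ← Nat.succ_mul]
      congr 1
      have := a.isLt
      omega
    have h4 := hlow a
    change e _ + (k + 1) ≤ n at h2
    simp only [Nat.mul_add, mul_one] at h1
    omega
  have hmono (a b : Fin i) (hab : a < b) : e a - a * k < e b - b * k := by
    have h1 := mul_add_le_of_gap hgap hab.le
    have h2 : (b : ℕ) * k = a * k + (b - a) * k := by
      rw [← Nat.add_mul]
      congr 1
      omega
    have h3 := hlow a
    have h4 : (a : ℕ) < b := hab
    simp only [Nat.mul_add, mul_one] at h1
    omega
  refine ⟨⟨fun a => ⟨e a - a * k, hup a⟩, ?_⟩, ?_⟩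
  · have : StrictMono fun a : Fin i => (⟨e a - a * k, hup a⟩ : Fin (n - i * k)) :=
      fun a b hab => hmono a b hab
    exact this.injective
  · have : S = univ.image e := by
      rw [← coe_inj, coe_image, coe_univ, Set.image_univ, S.range_orderEmbOfFin hScard]
    rw [this]
    refine image_congr fun a _ => ?_
    have := hlow a
    simp only [Function.Embedding.coeFn_mk]
    omega

open Classical in
/-- If occurrences of `q` never overlap, permutations with at least `i` of them are bounded by
the ways to choose `i` windows and the pattern of the collapsed permutation. -/
theorem card_le_numVTO_le {n k i : ℕ} (hk : 0 < k) {q : Equiv.Perm (Fin k)}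
    (hsep : ∀ p : Equiv.Perm (Fin n), ∀ s t, IsVTO p q s → IsVTO p q t → s < t → s + k ≤ t) :
    (univ.filter fun p : Equiv.Perm (Fin n) => i ≤ numVTO p q).card
      ≤ (n - i * (k - 1)).descFactorial i * (n - i * (k - 1)).factorial := by
  set m := n - i * (k - 1) with hm
  let W : (Fin i ↪ Fin m) → Finset ℕ := fun h => univ.image fun j => (h j : ℕ) + j * (k - 1)
  let H : Finset (Fin i ↪ Fin m) := univ.filter fun h =>
    (W h).card = i ∧ ∀ s ∈ W h, ∀ t ∈ W h, s < t → s + k ≤ t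
  let T : (Fin i ↪ Fin m) → Finset (Equiv.Perm (Fin n)) := fun h =>
    univ.filter fun p => ∀ s ∈ W h, IsVTO p q s
  have hT : ∀ h ∈ H, (T h).card ≤ m.factorial := by
    intro h hh
    obtain ⟨h1, h2⟩ := (mem_filter.1 hh).2
    refine (card_isVTO_le hk q (W h) h2).trans_eq ?_
    rw [h1]
  have hsub : (univ.filter fun p : Equiv.Perm (Fin n) => i ≤ numVTO p q) ⊆ H.biUnion T := by
    intro p hp
    have hp : i ≤ numVTO p q := (mem_filter.1 hp).2
    rw [numVTO, Set.ncard_eq_toFinset_card _ (finite_setOf_isVTO p q)] at hp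
    obtain ⟨S, hS, hcard⟩ := exists_subset_card_eq hp
    have hS (s) (hs : s ∈ S) : IsVTO p q s := by simpa using hS hs
    have hgap : ∀ s ∈ S, ∀ t ∈ S, s < t → s + k ≤ t :=
      fun s hs t ht => hsep p s t (hS s hs) (hS t ht)
    obtain ⟨h, rfl⟩ := exists_embedding_of_gap hk hcard hgap fun s hs => (hS s hs).1
    exact mem_biUnion.2 ⟨h, mem_filter.2 ⟨mem_univ _, hcard, hgap⟩,
      mem_filter.2 ⟨mem_univ _, hS⟩⟩
  refine (card_le_card hsub).trans ((card_biUnion_le_card_mul _ _ _ hT).trans ?_)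
  refine Nat.mul_le_mul_right _ ((card_filter_le _ _).trans_eq ?_)
  rw [card_univ, Fintype.card_embedding_eq, Fintype.card_fin, Fintype.card_fin]

theorem descFactorial_mul_factorial_le {m i N : ℕ} (hi : 2 ≤ i) (hm : 2 ≤ m)
    (hN : m + i ≤ N + 1) :
    m.descFactorial i * m.factorial ≤ (N - 2) * N.factorial := by
  obtain ⟨i, rfl⟩ := Nat.exists_eq_add_of_le' hi
  obtain ⟨m, rfl⟩ := Nat.exists_eq_add_of_le' hm
  have h1 : (m + 2).descFactorial (i + 2) ≤ (m + 1) * (m + 2) ^ (i + 1) := by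
    rw [Nat.succ_descFactorial_succ, Nat.succ_descFactorial_succ]
    calc (m + 1 + 1) * ((m + 1) * m.descFactorial i)
        ≤ (m + 1 + 1) * ((m + 1) * (m + 2) ^ i) := by
          gcongr
          exact (Nat.descFactorial_le_pow _ _).trans (Nat.pow_le_pow_left (by omega) _)
      _ = _ := by ring
  have h2 : (m + 2).factorial * (m + 2) ^ (i + 1) ≤ N.factorial :=
    calc (m + 2).factorial * (m + 2) ^ (i + 1) ≤ (m + 2).factorial * (m + 2 + 1) ^ (i + 1) :=
          Nat.mul_le_mul_left _ (Nat.pow_le_pow_left (by omega) _)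
      _ ≤ (m + 2 + (i + 1)).factorial := Nat.factorial_mul_pow_le_factorial
      _ ≤ N.factorial := Nat.factorial_le (by omega)
  calc (m + 2).descFactorial (i + 2) * (m + 2).factorial
      ≤ (m + 1) * (m + 2) ^ (i + 1) * (m + 2).factorial := Nat.mul_le_mul_right _ h1
    _ = (m + 1) * ((m + 2).factorial * (m + 2) ^ (i + 1)) := by ring
    _ ≤ (N - 2) * N.factorial := Nat.mul_le_mul (by omega) h2

end VeryTight

/-- Let `k ≥ 3`, let `q` be a non-condensible pattern of length `k` with first
entry smaller than last entry, let `α = 12⋯k` be the identity pattern, and let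
`i ≥ 2`. Then for every `n`, the number of `n`-permutations with at least `i`
very tight occurrences of `q` is at most the number of `n`-permutations with
at least `i` very tight occurrences of `α`. -/
theorem stmt_11 {k : ℕ} (hk : 3 ≤ k) (q : Equiv.Perm (Fin k))
    (hq : q ⟨0, by omega⟩ < q ⟨k - 1, by omega⟩) (hnc : ¬ Condensible q)
    (i : ℕ) (hi : 2 ≤ i) (n : ℕ) :
    Nat.card {p : Equiv.Perm (Fin n) // i ≤ numVTO p q}
      ≤ Nat.card {p : Equiv.Perm (Fin n) // i ≤ numVTO p (Equiv.refl (Fin k))} := by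
  classical
  rw [Nat.card_eq_fintype_card, Nat.card_eq_fintype_card, Fintype.card_subtype,
    Fintype.card_subtype]
  have hupper := VeryTight.card_le_numVTO_le (n := n) (i := i) (q := q) (by omega)
    fun p s t hs ht hst => VeryTight.add_le_of_isVTO (by omega) hq hnc hs ht hst
  refine hupper.trans ?_
  set m := n - i * (k - 1) with hm
  rcases lt_or_ge m i with hmi | hmi
  · rw [Nat.descFactorial_of_lt hmi, zero_mul]
    exact Nat.zero_le _
  obtain ⟨D, hD⟩ : ∃ D, D + 2 = k + i := ⟨k + i - 2, by omega⟩
  have hmul : i * (k - 1) = D + (i - 1) * (k - 2) := by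
    obtain ⟨i, rfl⟩ := Nat.exists_eq_add_of_le' hi
    obtain ⟨k, rfl⟩ := Nat.exists_eq_add_of_le' hk
    obtain rfl : D = k + i + 3 := by omega
    simp only [show k + 3 - 1 = k + 2 by omega, show i + 2 - 1 = i + 1 by omega,
      show k + 3 - 2 = k + 1 by omega]
    ring
  have hge : i - 1 ≤ (i - 1) * (k - 2) := Nat.le_mul_of_pos_right _ (by omega)
  obtain ⟨N, rfl⟩ : ∃ N, n = N + D := ⟨n - D, by omega⟩
  refine (VeryTight.descFactorial_mul_factorial_le (N := N) hi (by omega) (by omega)).trans ?_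
  refine (VeryTight.mul_factorial_le_card_exists_isVTO_refl (D := D) (by omega)).trans ?_
  refine Finset.card_le_card fun p hp => ?_
  obtain ⟨j, -, hj⟩ := (Finset.mem_filter.1 hp).2
  exact Finset.mem_filter.2 ⟨Finset.mem_univ _, VeryTight.le_numVTO_refl (by omega) hD hj⟩
end
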